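/- arXiv:1807.09550 — 5 statements merged into one kernel-verified Lean document; each statement's English description precedes it below -/
import Mathlib

section
/- Every nonzero homogeneous cubic form F in ℂ[x₀,x₁,x₂] has an apolar star configuration X(4): there exist four linear forms l₁, l₂, l₃, l₄ in the dual variables y₀, y₁, y₂ such that any three of them are linearly independent and D_{l_i}∘D_{l_j}∘D_{l_k}(F) = 0 for all 1 ≤ i < j < k ≤ 4. -/
open MvPolynomial

/-- The first-order differential operator `a₀∂₀ + ⋯ + aₙ∂ₙ` associated to the linear form
in the dual variables with coefficient vector `a`. -/
noncomputable def D {n : ℕ} (a : Fin n → ℂ) (F : MvPolynomial (Fin n) ℂ) :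
    MvPolynomial (Fin n) ℂ :=
  ∑ i, a i • pderiv i F

open Module

lemma forall_lt_lt_fin_four {P : Fin 4 → Fin 4 → Fin 4 → Prop} (h₀ : P 0 1 2) (h₁ : P 0 1 3)
    (h₂ : P 0 2 3) (h₃ : P 1 2 3) (i j k : Fin 4) (hij : i < j) (hjk : j < k) : P i j k := by
  fin_cases i <;> fin_cases j <;> fin_cases k <;> first | assumption | simp_all

section LinearAlgebra

variable {V : Type*} [AddCommGroup V] [Module ℂ V]

/-- Combinations of three independent vectors are independent if their coefficient matrix has
nonzero determinant. -/
lemma linearIndependent_comb {p q r : V} (h : LinearIndependent ℂ ![p, q, r])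
    (a b c : Fin 3 → ℂ) (hdet : (Matrix.of ![a, b, c]).det ≠ 0) :
    LinearIndependent ℂ ![a 0 • p + a 1 • q + a 2 • r, b 0 • p + b 1 • q + b 2 • r,
      c 0 • p + c 1 • q + c 2 • r] := by
  have h₁ := (Matrix.linearIndependent_rows_of_det_ne_zero hdet).map'
    (Fintype.linearCombination ℂ ![p, q, r])
    (LinearMap.ker_eq_bot.2 h.fintypeLinearCombination_injective)
  have e : ![a 0 • p + a 1 • q + a 2 • r, b 0 • p + b 1 • q + b 2 • r,
      c 0 • p + c 1 • q + c 2 • r] =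
      Fintype.linearCombination ℂ ![p, q, r] ∘ (Matrix.of ![a, b, c]).row := by
    ext i
    fin_cases i <;>
      simp [Function.comp_apply, Fintype.linearCombination_apply, Fin.sum_univ_three]
  rw [e]
  exact h₁

/-- `linearIndependent_comb` for vectors that are equal to the given combinations. -/
lemma linearIndependent_of_eq_comb {p q r u v w : V} (h : LinearIndependent ℂ ![p, q, r])
    (a b c : Fin 3 → ℂ) (hu : u = a 0 • p + a 1 • q + a 2 • r)
    (hv : v = b 0 • p + b 1 • q + b 2 • r) (hw : w = c 0 • p + c 1 • q + c 2 • r)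
    (hdet : (Matrix.of ![a, b, c]).det ≠ 0) : LinearIndependent ℂ ![u, v, w] := by
  rw [hu, hv, hw]
  exact linearIndependent_comb h a b c hdet

lemma exists_linearIndependent_three_of_pair (hV : finrank ℂ V = 3) {p q : V}
    (h : LinearIndependent ℂ ![p, q]) : ∃ r, LinearIndependent ℂ ![p, q, r] := by
  obtain ⟨r, hr⟩ := exists_linearIndependent_cons_of_lt_finrank h (by omega)
  have hr' : LinearIndependent ℂ ![r, p, q] := hr
  exact ⟨r, linearIndependent_of_eq_comb hr' ![0, 1, 0] ![0, 0, 1] ![1, 0, 0]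
    (by simp) (by simp) (by simp) (by simp [Matrix.det_fin_three])⟩

lemma exists_linearIndependent_three_of_ne_zero (hV : finrank ℂ V = 3) {p : V} (hp : p ≠ 0) :
    ∃ q r, LinearIndependent ℂ ![p, q, r] := by
  have h₁ : LinearIndependent ℂ ![p] := LinearIndependent.of_subsingleton 0 hp
  obtain ⟨q, hq⟩ := exists_linearIndependent_cons_of_lt_finrank h₁ (by omega)
  have hq' : LinearIndependent ℂ ![q, p] := hq
  exact ⟨q, exists_linearIndependent_three_of_pair hV (LinearIndependent.pair_symm_iff.1 hq')⟩

lemma linearIndependent_pair_of_three {p q r : V} (h : LinearIndependent ℂ ![p, q, r]) :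
    LinearIndependent ℂ ![p, q] := by
  have := h.comp ![0, 1] (by decide)
  convert this using 1
  ext i
  fin_cases i <;> rfl

lemma linearMap_eq_zero_of_linearIndependent_three (hV : finrank ℂ V = 3) {W : Type*}
    [AddCommGroup W] [Module ℂ W] {p q r : V} (h : LinearIndependent ℂ ![p, q, r])
    {f : V →ₗ[ℂ] W} (hp : f p = 0) (hq : f q = 0) (hr : f r = 0) : f = 0 := by
  refine (basisOfLinearIndependentOfCardEqFinrank h (by simp [hV])).ext fun i ↦ ?_
  fin_cases i <;> simp [hp, hq, hr]

/-- Two distinct scalars conjugate with respect to a symmetric bilinear form. -/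
lemma exists_ne_conjugate (α β γ : ℂ) (h : α = 0 → β = 0 → γ = 0) :
    ∃ v w : ℂ, v ≠ w ∧ α * (v * w) + β * (v + w) + γ = 0 := by
  by_cases hα : α = 0
  · subst hα
    by_cases hβ : β = 0
    · exact ⟨0, 1, by simp, by simp [hβ, h rfl hβ]⟩
    · refine ⟨-γ / (2 * β) + 1, -γ / (2 * β) - 1, fun h ↦ ?_, by field_simp; ring⟩
      have : (2 : ℂ) = 0 := by linear_combination h
      norm_num at this
  · have key : ∃ s t : ℂ, s ≠ t ∧ s * t = (β ^ 2 - α * γ) / α ^ 2 := by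
      generalize (β ^ 2 - α * γ) / α ^ 2 = k
      by_cases hk : k = 1
      · exact ⟨2, 1 / 2, by norm_num, by rw [hk]; norm_num⟩
      · exact ⟨1, k, Ne.symm hk, one_mul k⟩
    obtain ⟨s, t, hst, hk⟩ := key
    refine ⟨s - β / α, t - β / α, fun h ↦ hst (by linear_combination h), ?_⟩
    have e : α * ((s - β / α) * (t - β / α)) + β * (s - β / α + (t - β / α)) + γ
        = α * (s * t) - β ^ 2 / α + γ := by field_simp; ring
    rw [e, hk]
    field_simp
    ring

lemma exists_quadratic_root (a b : ℂ) {c : ℂ} (hc : c ≠ 0) :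
    ∃ x : ℂ, a + b * x + c * x ^ 2 = 0 := by
  obtain ⟨s, hs⟩ := IsAlgClosed.exists_eq_mul_self (discrim c b a)
  obtain ⟨x, hx⟩ := exists_quadratic_eq_zero hc ⟨s, hs⟩
  exact ⟨x, by linear_combination hx⟩

/-- Invariance of a trilinear form under permutations of its arguments. -/
structure IsSymmTrilinear (T : V →ₗ[ℂ] V →ₗ[ℂ] V →ₗ[ℂ] ℂ) : Prop where
  swap_left : ∀ u v w, T u v w = T v u w
  swap_right : ∀ u v w, T u v w = T u w v

/-- Four vectors in general position such that a trilinear form vanishes on any three of them. -/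
def HasStar (T : V →ₗ[ℂ] V →ₗ[ℂ] V →ₗ[ℂ] ℂ) : Prop :=
  ∃ l : Fin 4 → V,
    (∀ i j k : Fin 4, i < j → j < k → LinearIndependent ℂ ![l i, l j, l k]) ∧
    (∀ i j k : Fin 4, i < j → j < k → T (l i) (l j) (l k) = 0)

namespace IsSymmTrilinear

variable {T : V →ₗ[ℂ] V →ₗ[ℂ] V →ₗ[ℂ] ℂ}

lemma rotate (hT : IsSymmTrilinear T) (u v w : V) : T u v w = T w u v := by
  rw [hT.swap_right, hT.swap_left]

/-- If `p` and `q` are conjugate, and neither of them is a singular point of the cubic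
`T v v v = 0` unless that cubic is a cone with vertex there, then `p` and `q` belong to a star. -/
lemma hasStar_of_conjugate (hT : IsSymmTrilinear T) (hV : finrank ℂ V = 3) {p q : V}
    (hpq : LinearIndependent ℂ ![p, q]) (h : T p q = 0) (hp : T p p = 0 → T p = 0)
    (hq : T q q = 0 → T q = 0) : HasStar T := by
  obtain ⟨r, hr⟩ := exists_linearIndependent_three_of_pair hV hpq
  have h' : T q p = 0 := by ext w; rw [hT.swap_left, h]
  have hpq0 (u) : T p q u = 0 := by simp [h]
  have hqp0 (u) : T q p u = 0 := by simp [h']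
  have hpuq (u) : T p u q = 0 := by rw [hT.swap_right, hpq0]
  have hqup (u) : T q u p = 0 := by rw [hT.swap_right, hqp0]
  obtain ⟨v₁, w₁, hne₁, e₁⟩ := exists_ne_conjugate (T p p p) (T p p r) (T p r r) (by
    intro h₁ h₂
    simp [hp (linearMap_eq_zero_of_linearIndependent_three hV hr h₁ (hpuq p) h₂)])
  obtain ⟨v₂, w₂, hne₂, e₂⟩ := exists_ne_conjugate (T q q q) (T q q r) (T q r r) (by
    intro h₁ h₂
    simp [hq (linearMap_eq_zero_of_linearIndependent_three hV hr (hqup q) h₁ h₂)])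
  have hne₁' := sub_ne_zero.2 hne₁
  have hne₂' := sub_ne_zero.2 hne₂
  refine ⟨![p, q, v₁ • p + v₂ • q + r, w₁ • p + w₂ • q + r],
    forall_lt_lt_fin_four ?_ ?_ ?_ ?_, forall_lt_lt_fin_four ?_ ?_ ?_ ?_⟩
  · exact linearIndependent_of_eq_comb hr ![1, 0, 0] ![0, 1, 0] ![v₁, v₂, 1]
      (by simp) (by simp) (by simp) (by simp [Matrix.det_fin_three])
  · exact linearIndependent_of_eq_comb hr ![1, 0, 0] ![0, 1, 0] ![w₁, w₂, 1]
      (by simp) (by simp) (by simp) (by simp [Matrix.det_fin_three])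
  · exact linearIndependent_of_eq_comb hr ![1, 0, 0] ![v₁, v₂, 1] ![w₁, w₂, 1]
      (by simp) (by simp) (by simp) (by simpa [Matrix.det_fin_three] using hne₂')
  · refine linearIndependent_of_eq_comb hr ![0, 1, 0] ![v₁, v₂, 1] ![w₁, w₂, 1]
      (by simp) (by simp) (by simp) ?_
    simp only [Matrix.det_fin_three]
    simpa [neg_add_eq_zero] using hne₁
  · simp [hpq0]
  · simp [hpq0]
  · have : T p r p = T p p r := hT.swap_right _ _ _
    simp [hpq0, hpuq, this]
    linear_combination e₁
  · have : T q r q = T q q r := hT.swap_right _ _ _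
    simp [hqp0, hqup, this]
    linear_combination e₂

lemma hasStar_of_cone (hT : IsSymmTrilinear T) (hV : finrank ℂ V = 3) {p : V} (hp : p ≠ 0)
    (h : T p = 0) : HasStar T := by
  by_cases hex : ∃ q, LinearIndependent ℂ ![p, q] ∧ T q q ≠ 0
  · obtain ⟨q, hq, hqq⟩ := hex
    exact hT.hasStar_of_conjugate hV hq (by simp [h]) (fun _ ↦ h) (fun h₀ ↦ absurd h₀ hqq)
  push Not at hex
  have hsq (v : V) : T v v = 0 := by
    by_cases hv : LinearIndependent ℂ ![p, v]
    · exact hex v hv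
    · rw [LinearIndependent.pair_iff' hp] at hv
      push Not at hv
      obtain ⟨a, rfl⟩ := hv
      simp [h]
  have hzero : T = 0 := by
    ext u v w
    have h₁ : T (u + v) (u + v) w = 0 := by rw [hsq, LinearMap.zero_apply]
    have h₂ : T u u w = 0 := by simp [hsq]
    have h₃ : T v v w = 0 := by simp [hsq]
    have h₄ := hT.swap_left v u w
    simp only [map_add, LinearMap.add_apply] at h₁
    simp only [LinearMap.zero_apply]
    linear_combination (h₁ - h₂ - h₃ - h₄) / 2
  obtain ⟨q, r, hr⟩ := exists_linearIndependent_three_of_ne_zero hV hp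
  exact hT.hasStar_of_conjugate hV (linearIndependent_pair_of_three hr) (by simp [h])
    (fun _ ↦ h) (fun _ ↦ by simp [hzero])

lemma hasStar_of_node (hT : IsSymmTrilinear T) (hV : finrank ℂ V = 3) {p s t : V}
    (hli : LinearIndependent ℂ ![p, s, t]) (hp : T p p = 0) (hss : T p s s = 0)
    (htt : T p t t = 0) (hst : T p s t ≠ 0) : HasStar T := by
  have hpp (u) : T p p u = 0 := by simp [hp]
  have hpup (u) : T p u p = 0 := by rw [hT.swap_right, hpp]
  have hupp (u) : T u p p = 0 := by rw [hT.swap_left, hpup]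
  have e₁ : T p t s = T p s t := hT.swap_right _ _ _
  have e₂ : T s p t = T p s t := hT.swap_left _ _ _
  have e₃ : T t p s = T p s t := by rw [hT.swap_left, e₁]
  have e₄ : T s p s = 0 := by rw [hT.swap_left, hss]
  have e₅ : T t p t = 0 := by rw [hT.swap_left, htt]
  have e₆ : T s s p = 0 := by rw [hT.swap_right, e₄]
  have e₇ : T t t p = 0 := by rw [hT.swap_right, e₅]
  have e₈ : T s t p = T p s t := by rw [hT.swap_right, e₂]
  have e₉ : T t s p = T p s t := by rw [hT.swap_right, e₃]
  have f₁ : T t s s = T s s t := hT.rotate _ _ _ |>.trans (hT.rotate _ _ _)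
  have f₂ : T s t s = T s s t := hT.swap_right _ _ _
  have f₃ : T t s t = T s t t := hT.swap_left _ _ _
  have f₄ : T t t s = T s t t := hT.rotate _ _ _
  set m := T p s t with hm
  obtain ⟨x, y, hx, hy⟩ : ∃ x y : ℂ, (x + y) * m = T t t t - T s s t ∧
      (x - y) * m = T s s s - T s t t :=
    ⟨((T t t t - T s s t) + (T s s s - T s t t)) / (2 * m),
      ((T t t t - T s s t) - (T s s s - T s t t)) / (2 * m),
      by field_simp; ring, by field_simp; ring⟩
  have hPQ : LinearIndependent ℂ ![x • p + s + t, y • p + s - t, p] :=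
    linearIndependent_of_eq_comb hli ![x, 1, 1] ![y, 1, -1] ![1, 0, 0]
      (by simp) (by simp [sub_eq_add_neg]) (by simp)
      (by simp [Matrix.det_fin_three]; norm_num)
  refine hT.hasStar_of_conjugate hV (linearIndependent_pair_of_three hPQ)
    (linearMap_eq_zero_of_linearIndependent_three hV hli ?_ ?_ ?_) (fun h₀ ↦ ?_) (fun h₀ ↦ ?_)
  · simp [hpp, hpup, hupp, e₆, e₇, e₈, e₉]
  · simp [hpp, hss, e₁, e₃, e₄, f₁, f₂, f₄]
    linear_combination -hy
  · simp [hpp, htt, e₂, e₅, f₃, ← hm]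
    linear_combination hx
  · have := LinearMap.congr_fun h₀ p
    simp [hpp, hpup, hupp, e₆, e₇, e₈, e₉] at this
    exact absurd this hst
  · have := LinearMap.congr_fun h₀ p
    simp [hpp, hpup, hupp, e₆, e₇, e₈, e₉] at this
    refine absurd ?_ hst
    linear_combination -this / 2

/-- A conic together with a tangent line: a star is found on a second conic. -/
lemma hasStar_of_tangent_conic (hT : IsSymmTrilinear T) {p s t : V}
    (hli : LinearIndependent ℂ ![p, s, t]) (hp : T p p = 0) (hpt : T p t = 0)
    (hss : T p s s ≠ 0) (httt : T t t t = 0) (hstt : T s t t ≠ 0) : HasStar T := by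
  have hpp (u) : T p p u = 0 := by simp [hp]
  have hpup (u) : T p u p = 0 := by rw [hT.swap_right, hpp]
  have hupp (u) : T u p p = 0 := by rw [hT.swap_left, hpup]
  have g₁ (u) : T p t u = 0 := by simp [hpt]
  have g₂ (u) : T p u t = 0 := by rw [hT.swap_right, g₁]
  have g₃ (u) : T u p t = 0 := by rw [hT.swap_left, g₂]
  have g₄ (u) : T u t p = 0 := by rw [hT.swap_right, g₃]
  have g₅ (u) : T t p u = 0 := by rw [hT.swap_left, g₁]
  have g₆ (u) : T t u p = 0 := by rw [hT.swap_right, g₅]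
  have e₄ : T s p s = T p s s := hT.swap_left _ _ _
  have e₆ : T s s p = T p s s := by rw [hT.swap_right, e₄]
  have f₁ : T t s s = T s s t := hT.rotate _ _ _ |>.trans (hT.rotate _ _ _)
  have f₂ : T s t s = T s s t := hT.swap_right _ _ _
  have f₃ : T t s t = T s t t := hT.swap_left _ _ _
  have f₄ : T t t s = T s t t := hT.rotate _ _ _
  set m := T p s s with hm
  obtain ⟨A, hA⟩ : ∃ A, A * m = -T s s s / 3 - 5 / 3 * T s t t :=
    ⟨(-T s s s / 3 - 5 / 3 * T s t t) / m, by field_simp⟩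
  obtain ⟨B, hB⟩ : ∃ B, B * m = -T s s t := ⟨-T s s t / m, by field_simp⟩
  obtain ⟨C, hC⟩ : ∃ C, C * m = T s t t := ⟨T s t t / m, by field_simp⟩
  have hC0 : C ≠ 0 := by
    rintro rfl
    exact hstt (by simpa using hC.symm)
  let P : ℂ → V := fun z ↦ (A + B * z + C * z ^ 2) • p + s + z • t
  have hPli (x y z : ℂ) (h : (x - y) * (y - z) * (z - x) ≠ 0) :
      LinearIndependent ℂ ![P x, P y, P z] := by
    refine linearIndependent_of_eq_comb hli ![A + B * x + C * x ^ 2, 1, x]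
      ![A + B * y + C * y ^ 2, 1, y] ![A + B * z + C * z ^ 2, 1, z]
      (by simp [P]) (by simp [P]) (by simp [P]) ?_
    have e : (Matrix.of ![![A + B * x + C * x ^ 2, 1, x], ![A + B * y + C * y ^ 2, 1, y],
        ![A + B * z + C * z ^ 2, 1, z]]).det = C * ((x - y) * (y - z) * (z - x)) := by
      simp [Matrix.det_fin_three]
      ring
    rw [e]
    exact mul_ne_zero hC0 h
  have hPT (x y z : ℂ)
      (h : x ^ 2 + y ^ 2 + z ^ 2 + (x * y + x * z + y * z) = 5) : T (P x) (P y) (P z) = 0 := by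
    simp [P, hpp, hpup, hupp, g₁, g₂, g₃, g₄, g₅, g₆, e₄, e₆, f₁, f₂, f₃, f₄, httt, ← hm]
    linear_combination 3 * hA + (x + y + z) * hB + (x ^ 2 + y ^ 2 + z ^ 2) * hC + T s t t * h
  refine ⟨![P 1, P (-1), P 2, P (-2)],
    forall_lt_lt_fin_four (hPli _ _ _ ?_) (hPli _ _ _ ?_) (hPli _ _ _ ?_) (hPli _ _ _ ?_),
    forall_lt_lt_fin_four (hPT _ _ _ ?_) (hPT _ _ _ ?_) (hPT _ _ _ ?_) (hPT _ _ _ ?_)⟩ <;>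
  norm_num

lemma hasStar_of_cusp (hT : IsSymmTrilinear T) (hV : finrank ℂ V = 3) {p s t : V}
    (hli : LinearIndependent ℂ ![p, s, t]) (hp : T p p = 0) (hpt : T p t = 0)
    (hss : T p s s ≠ 0) : HasStar T := by
  have hpp (u) : T p p u = 0 := by simp [hp]
  have hpup (u) : T p u p = 0 := by rw [hT.swap_right, hpp]
  have hupp (u) : T u p p = 0 := by rw [hT.swap_left, hpup]
  have g₁ (u) : T p t u = 0 := by simp [hpt]
  have g₂ (u) : T p u t = 0 := by rw [hT.swap_right, g₁]
  have g₃ (u) : T u p t = 0 := by rw [hT.swap_left, g₂]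
  have g₄ (u) : T u t p = 0 := by rw [hT.swap_right, g₃]
  have g₅ (u) : T t p u = 0 := by rw [hT.swap_left, g₁]
  have g₆ (u) : T t u p = 0 := by rw [hT.swap_right, g₅]
  have e₄ : T s p s = T p s s := hT.swap_left _ _ _
  have e₆ : T s s p = T p s s := by rw [hT.swap_right, e₄]
  have f₁ : T t s s = T s s t := hT.rotate _ _ _ |>.trans (hT.rotate _ _ _)
  have f₂ : T s t s = T s s t := hT.swap_right _ _ _
  have f₃ : T t s t = T s t t := hT.swap_left _ _ _
  have f₄ : T t t s = T s t t := hT.rotate _ _ _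
  set m := T p s s with hm
  by_cases httt : T t t t = 0
  · by_cases hstt : T s t t = 0
    · have hne : LinearIndependent ℂ ![(-(T s s t / m)) • p + t, s, p] :=
        linearIndependent_of_eq_comb hli ![-(T s s t / m), 0, 1] ![0, 1, 0] ![1, 0, 0]
          (by simp) (by simp) (by simp) (by simp [Matrix.det_fin_three])
      refine hT.hasStar_of_cone hV (hne.ne_zero 0)
        (linearMap_eq_zero_of_linearIndependent_three hV hli ?_ ?_ ?_)
      · ext u
        simp [hpp, g₅]
      · refine linearMap_eq_zero_of_linearIndependent_three hV hli ?_ ?_ ?_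
        · simp [hpup, g₆]
        · simp [f₁, ← hm]
          field_simp
          ring
        · simp [g₂, f₃, hstt]
      · refine linearMap_eq_zero_of_linearIndependent_three hV hli ?_ ?_ ?_
        · simp [g₁, g₄]
        · simp [g₁, f₄, hstt]
        · simp [g₁, httt]
    · exact hT.hasStar_of_tangent_conic hli hp hpt hss httt hstt
  · obtain ⟨x, hx⟩ : ∃ x, T s t t + x * T t t t = 0 :=
      ⟨-T s t t / T t t t, by field_simp; ring⟩
    obtain ⟨y, hy⟩ : ∃ y, y * m + T s s t + x * T s t t = 0 :=
      ⟨-(T s s t + x * T s t t) / m, by field_simp; ring⟩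
    have hPQ : LinearIndependent ℂ ![s + x • t, y • p + t, p] :=
      linearIndependent_of_eq_comb hli ![0, 1, x] ![y, 0, 1] ![1, 0, 0]
        (by simp) (by simp) (by simp) (by simp [Matrix.det_fin_three])
    refine hT.hasStar_of_conjugate hV (linearIndependent_pair_of_three hPQ)
      (linearMap_eq_zero_of_linearIndependent_three hV hli ?_ ?_ ?_) (fun h₀ ↦ ?_) (fun h₀ ↦ ?_)
    · simp [hupp, g₄]
    · simp [g₅, e₄, f₂, f₄]
      linear_combination hy
    · simp [g₃]
      linear_combination hx
    · have := LinearMap.congr_fun h₀ p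
      simp [e₆, g₄, g₆] at this
      exact absurd this hss
    · have := LinearMap.congr_fun h₀ t
      simp [g₂, g₃] at this
      exact absurd this httt

lemma hasStar_of_singular (hT : IsSymmTrilinear T) (hV : finrank ℂ V = 3) {p : V} (hp : p ≠ 0)
    (hpp : T p p = 0) : HasStar T := by
  by_cases hp0 : T p = 0
  · exact hT.hasStar_of_cone hV hp hp0
  obtain ⟨s, t, hli, htt⟩ : ∃ s t, LinearIndependent ℂ ![p, s, t] ∧ T p t t = 0 := by
    obtain ⟨s, t, hli⟩ := exists_linearIndependent_three_of_ne_zero hV hp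
    by_cases hss : T p s s = 0
    · exact ⟨t, s, linearIndependent_of_eq_comb hli ![1, 0, 0] ![0, 0, 1] ![0, 1, 0]
        (by simp) (by simp) (by simp) (by simp [Matrix.det_fin_three]), hss⟩
    · obtain ⟨x, hx⟩ := exists_quadratic_root (T p t t) (2 * T p s t) hss
      refine ⟨s, x • s + t, linearIndependent_of_eq_comb hli ![1, 0, 0] ![0, 1, 0] ![0, x, 1]
        (by simp) (by simp) (by simp) (by simp [Matrix.det_fin_three]), ?_⟩
      have := hT.swap_right p t s
      simp [this]
      linear_combination hx
  have hup (u) : T p u p = 0 := by rw [hT.swap_right, hpp, LinearMap.zero_apply]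
  have hts : T p t s = T p s t := hT.swap_right _ _ _
  by_cases hst : T p s t = 0
  · have hpt : T p t = 0 :=
      linearMap_eq_zero_of_linearIndependent_three hV hli (hup t) (hts.trans hst) htt
    refine hT.hasStar_of_cusp hV hli hpp hpt fun hss ↦ hp0 ?_
    exact linearMap_eq_zero_of_linearIndependent_three hV hli hpp
      (linearMap_eq_zero_of_linearIndependent_three hV hli (hup s) hss hst) hpt
  · obtain ⟨x, hx⟩ : ∃ x, T p s s + 2 * x * T p s t = 0 :=
      ⟨-T p s s / (2 * T p s t), by field_simp; ring⟩
    have hli' : LinearIndependent ℂ ![p, s + x • t, t] :=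
      linearIndependent_of_eq_comb hli ![1, 0, 0] ![0, 1, x] ![0, 0, 1]
        (by simp) (by simp) (by simp) (by simp [Matrix.det_fin_three])
    refine hT.hasStar_of_node hV hli' hpp ?_ htt ?_
    · simp [hts, htt]
      linear_combination hx
    · simpa [htt] using hst

/-- The Hessian curve of a ternary cubic is nonempty. -/
lemma exists_conjugate (T : V →ₗ[ℂ] V →ₗ[ℂ] V →ₗ[ℂ] ℂ) (hV : finrank ℂ V = 3) :
    ∃ p q : V, p ≠ 0 ∧ q ≠ 0 ∧ T p q = 0 := by
  have : FiniteDimensional ℂ V := FiniteDimensional.of_finrank_pos (by omega)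
  have : Nontrivial V := nontrivial_of_finrank_pos (R := ℂ) (by omega)
  obtain ⟨e, he⟩ := exists_ne (0 : V)
  obtain ⟨f, g, hli⟩ := exists_linearIndependent_three_of_ne_zero hV he
  by_cases hinj : Function.Injective (T e)
  · let φ : V ≃ₗ[ℂ] (V →ₗ[ℂ] ℂ) :=
      LinearEquiv.ofInjectiveOfFinrankEq (T e) hinj (Subspace.dual_finrank_eq).symm
    obtain ⟨μ, hμ⟩ := End.exists_eigenvalue (φ.symm.toLinearMap ∘ₗ T f)
    obtain ⟨q, hq⟩ := hμ.exists_hasEigenvector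
    refine ⟨f - μ • e, q, fun h ↦ ?_, hq.2, ?_⟩
    · have := LinearIndependent.pair_iff.1 (linearIndependent_pair_of_three hli) (-μ) 1
        (by rw [← h]; module)
      exact one_ne_zero this.2
    · have h₁ : φ.symm (T f q) = μ • q := hq.apply_eq_smul
      rw [LinearEquiv.symm_apply_eq, map_smul] at h₁
      have h₂ : φ q = T e q := rfl
      simp [h₁, h₂]
  · rw [injective_iff_map_eq_zero] at hinj
    push Not at hinj
    obtain ⟨q, hq, hq0⟩ := hinj
    exact ⟨e, q, he, hq0, hq⟩

theorem hasStar (hT : IsSymmTrilinear T) (hV : finrank ℂ V = 3) : HasStar T := by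
  by_cases hsing : ∃ p, p ≠ 0 ∧ T p p = 0
  · obtain ⟨p, hp, hpp⟩ := hsing
    exact hT.hasStar_of_singular hV hp hpp
  push Not at hsing
  obtain ⟨p, q, hp, hq, hpq⟩ := exists_conjugate T hV
  refine hT.hasStar_of_conjugate hV ((LinearIndependent.pair_iff' hp).2 ?_) hpq
    (fun h ↦ absurd h (hsing p hp)) (fun h ↦ absurd h (hsing q hq))
  rintro a rfl
  rw [map_smul, smul_eq_zero] at hpq
  exact hpq.elim (fun ha ↦ hq (by simp [ha])) (hsing p hp)

end IsSymmTrilinear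
end LinearAlgebra

section Apolarity

variable {n : ℕ}

/-- The operator `D a`, bundled as a linear map in both arguments. -/
noncomputable def linearD :
    (Fin n → ℂ) →ₗ[ℂ] MvPolynomial (Fin n) ℂ →ₗ[ℂ] MvPolynomial (Fin n) ℂ :=
  ∑ i, (LinearMap.proj i).smulRight (pderiv i).toLinearMap

lemma linearD_apply (a : Fin n → ℂ) (F : MvPolynomial (Fin n) ℂ) : linearD a F = D a F := by
  simp [linearD, D, LinearMap.sum_apply]

lemma pderiv_comm (i j : Fin n) (F : MvPolynomial (Fin n) ℂ) :
    pderiv i (pderiv j F) = pderiv j (pderiv i F) := by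
  have h : ⁅pderiv (R := ℂ) i, pderiv (R := ℂ) j⁆ = 0 := by
    refine MvPolynomial.derivation_ext fun k ↦ ?_
    simp only [Derivation.commutator_apply, pderiv_X, Derivation.zero_apply, Pi.single_apply]
    split_ifs <;> simp
  have := DFunLike.congr_fun h F
  rwa [Derivation.commutator_apply, Derivation.zero_apply, sub_eq_zero] at this

lemma D_comm (a b : Fin n → ℂ) (F : MvPolynomial (Fin n) ℂ) : D a (D b F) = D b (D a F) := by
  simp only [D, map_sum, Derivation.map_smul, Finset.smul_sum]
  rw [Finset.sum_comm]
  refine Finset.sum_congr rfl fun i _ ↦ Finset.sum_congr rfl fun j _ ↦ ?_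
  rw [pderiv_comm, smul_comm]

lemma isHomogeneous_D {m : ℕ} (a : Fin n → ℂ) {F : MvPolynomial (Fin n) ℂ}
    (hF : F.IsHomogeneous m) : (D a F).IsHomogeneous (m - 1) :=
  IsHomogeneous.sum _ _ _ fun i _ ↦
    (homogeneousSubmodule (Fin n) ℂ (m - 1)).smul_mem (a i) hF.pderiv

/-- The polarization of a cubic form, up to a factor: the constant term of the third-order
derivative of the form. -/
noncomputable def polarization (F : MvPolynomial (Fin n) ℂ) :
    (Fin n → ℂ) →ₗ[ℂ] (Fin n → ℂ) →ₗ[ℂ] (Fin n → ℂ) →ₗ[ℂ] ℂ :=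
  LinearMap.mk₂ ℂ (fun u v ↦ lcoeff ℂ 0 ∘ₗ linearD u ∘ₗ linearD v ∘ₗ linearD.flip F)
    (fun _ _ _ ↦ by ext; simp) (fun _ _ _ ↦ by ext; simp)
    (fun _ _ _ ↦ by ext; simp) (fun _ _ _ ↦ by ext; simp)

lemma polarization_apply (F : MvPolynomial (Fin n) ℂ) (u v w : Fin n → ℂ) :
    polarization F u v w = coeff 0 (D u (D v (D w F))) := by
  simp [polarization, linearD_apply]

lemma isSymmTrilinear_polarization (F : MvPolynomial (Fin n) ℂ) :
    IsSymmTrilinear (polarization F) where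
  swap_left u v w := by rw [polarization_apply, polarization_apply, D_comm]
  swap_right u v w := by rw [polarization_apply, polarization_apply, D_comm v w]

end Apolarity

/-- Every nonzero ternary cubic form has an apolar star configuration `X(4)`:
four linear forms in the dual variables, any three of which are linearly independent,
such that every triple product annihilates `F`. -/
theorem every_ternary_cubic_has_apolar_star_configuration
    (F : MvPolynomial (Fin 3) ℂ) (hF0 : F ≠ 0) (hF : F.IsHomogeneous 3) :
    ∃ l : Fin 4 → Fin 3 → ℂ,
      (∀ i j k : Fin 4, i < j → j < k → LinearIndependent ℂ ![l i, l j, l k]) ∧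
      (∀ i j k : Fin 4, i < j → j < k → D (l i) (D (l j) (D (l k) F)) = 0) := by
  obtain ⟨l, hli, hl⟩ := (isSymmTrilinear_polarization F).hasStar (by simp)
  refine ⟨l, hli, fun i j k hij hjk ↦ ?_⟩
  have hD : (D (l i) (D (l j) (D (l k) F))).IsHomogeneous 0 :=
    isHomogeneous_D _ (isHomogeneous_D _ (isHomogeneous_D _ hF))
  have h := hl i j k hij hjk
  rw [polarization_apply] at h
  rw [totalDegree_eq_zero_iff_eq_C.1 ((totalDegree_zero_iff_isHomogeneous _).2 hD), h, C_0]
end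

section
/- Let C = x₀³ − x₁²x₂ ∈ ℂ[x₀,x₁,x₂] (the normal form of a cuspidal ternary cubic). The four linear forms l₁ = y₀, l₂ = y₁, l₃ = y₁ − y₂, l₄ = y₀ + y₁ + y₂ satisfy: any three of them are linearly independent, and D_{l_i}∘D_{l_j}∘D_{l_k}(C) = 0 for all 1 ≤ i < j < k ≤ 4. Hence C has an apolar star configuration X(4). -/
open MvPolynomial

theorem pderiv_ofNat {σ R : Type*} [CommSemiring R] (i : σ) (n : ℕ) [n.AtLeastTwo] :
    pderiv i (ofNat(n) : MvPolynomial σ R) = 0 :=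
  (pderiv i).map_natCast n

/-- For the cuspidal cubic `C = x₀³ − x₁²x₂`, the four dual linear forms
`l₁ = y₀`, `l₂ = y₁`, `l₃ = y₁ − y₂`, `l₄ = y₀ + y₁ + y₂` have any three of them linearly
independent and all triple products annihilate `C`; hence `C` has an apolar star
configuration `X(4)`. -/
theorem cuspidal_cubic_explicit_apolar_star_configuration :
    let P : MvPolynomial (Fin 3) ℂ := X 0 ^ 3 - X 1 ^ 2 * X 2
    let l : Fin 4 → Fin 3 → ℂ := ![![1, 0, 0], ![0, 1, 0], ![0, 1, -1], ![1, 1, 1]]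
    (∀ i j k : Fin 4, i < j → j < k → LinearIndependent ℂ ![l i, l j, l k]) ∧
      (∀ i j k : Fin 4, i < j → j < k → D (l i) (D (l j) (D (l k) P)) = 0) := by
  intro P l
  refine ⟨fun i j k hij hjk => ?_, fun i j k hij hjk => ?_⟩
  · have hdet : IsUnit (Matrix.of ![l i, l j, l k]).det := by
      rw [isUnit_iff_ne_zero, Matrix.det_fin_three]
      fin_cases i <;> fin_cases j <;> first | (exfalso; revert hij; decide) | skip
      all_goals fin_cases k <;> first | (exfalso; revert hjk; decide) | simp [l]
    exact Matrix.linearIndependent_rows_iff_isUnit.mpr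
      ((Matrix.isUnit_iff_isUnit_det _).mpr hdet)
  · fin_cases i <;> fin_cases j <;> first | (exfalso; revert hij; decide) | skip
    all_goals
      fin_cases k <;> first
        | (exfalso; revert hjk; decide)
        | simp [l, P, D, Fin.sum_univ_three, pderiv_X, Pi.single_apply, pderiv_ofNat]
end

section
/- The Waring rank of the ternary cubic x₀³ − x₁²x₂ over ℂ is 4: there exist linear forms L₁, L₂, L₃, L₄ in ℂ[x₀,x₁,x₂] with x₀³ − x₁²x₂ = L₁³ + L₂³ + L₃³ + L₄³, and there is no expression of x₀³ − x₁²x₂ as a sum of 3 or fewer cubes of linear forms. -/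
open MvPolynomial

/-- The linear form `a₀x₀ + ⋯ + aₙxₙ` with coefficient vector `a`. -/
noncomputable def lin {n : ℕ} (a : Fin n → ℂ) : MvPolynomial (Fin n) ℂ :=
  ∑ i, MvPolynomial.C (a i) * X i

/-- The polynomial function `x³ - y²z` is not a sum of three cubes of linear functions. -/
lemma cuspidal_cubic_not_sum_three_cubes (a b c : Fin 3 → ℂ)
    (h : ∀ x y z : ℂ, x ^ 3 - y ^ 2 * z = ∑ i, (a i * x + b i * y + c i * z) ^ 3) : False := by
  simp only [Fin.sum_univ_three] at h
  have hx := h 1 0 0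
  have hy := h 0 1 0
  have hz := h 0 0 1
  have hxy := h 1 1 0
  have hxy' := h 1 (-1) 0
  have hxz := h 1 0 1
  have hxz' := h 1 0 (-1)
  have hyz := h 0 1 1
  have hyz' := h 0 1 (-1)
  have hxyz := h 1 1 1
  -- Multiplying the coefficient matrix by the columns `a²`, `bc`, `b²` gives an invertible matrix.
  have hprod : !![a 0, a 1, a 2; b 0, b 1, b 2; c 0, c 1, c 2] *
      !![a 0 ^ 2, b 0 * c 0, b 0 ^ 2; a 1 ^ 2, b 1 * c 1, b 1 ^ 2;
        a 2 ^ 2, b 2 * c 2, b 2 ^ 2] = !![1, 0, 0; 0, -1 / 3, 0; 0, 0, -1 / 3] := by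
    ext i j
    fin_cases i <;> fin_cases j <;> simp [Matrix.mul_apply, Fin.sum_univ_three]
    · linear_combination -hx
    · linear_combination (-hxyz + hxy + hxz + hyz - hx - hy - hz) / 6
    · linear_combination (-hxy - hxy' + 2 * hx) / 6
    · linear_combination (-hxy + hxy' + 2 * hy) / 6
    · linear_combination (-hyz + hyz' + 2 * hz) / 6
    · linear_combination -hy
    · linear_combination (-hxz + hxz' + 2 * hz) / 6
    · linear_combination (-hyz - hyz' + 2 * hy) / 6
    · linear_combination (-hyz + hyz' + 2 * hz) / 6
  have hdet : (!![a 0, a 1, a 2; b 0, b 1, b 2; c 0, c 1, c 2]).det ≠ 0 := by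
    intro h0
    have := congrArg Matrix.det hprod
    rw [Matrix.det_mul, h0] at this
    simp [Matrix.det_fin_three] at this
  have hker : !![a 0, a 1, a 2; b 0, b 1, b 2; c 0, c 1, c 2].mulVec
      ![c 0 ^ 2, c 1 ^ 2, c 2 ^ 2] = 0 := by
    ext i
    fin_cases i <;> simp [Matrix.mulVec, dotProduct, Fin.sum_univ_three]
    · linear_combination (-hxz - hxz' + 2 * hx) / 6
    · linear_combination (-hyz - hyz' + 2 * hy) / 6
    · linear_combination -hz
  have hc := Matrix.eq_zero_of_mulVec_eq_zero hdet hker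
  have h0 : c 0 = 0 := by simpa using congrFun hc 0
  have h1 : c 1 = 0 := by simpa using congrFun hc 1
  have h2 : c 2 = 0 := by simpa using congrFun hc 2
  rw [h0, h1, h2] at hyz
  exact one_ne_zero (α := ℂ) (by linear_combination -hyz + hy)

/-- The Waring rank of `x₀³ − x₁²x₂` is `4`: it is a sum of four cubes of linear forms,
but not a sum of three or fewer cubes of linear forms. -/
theorem waring_rank_cuspidal_cubic_eq_four :
    let P : MvPolynomial (Fin 3) ℂ := X 0 ^ 3 - X 1 ^ 2 * X 2
    (∃ L : Fin 4 → Fin 3 → ℂ, P = ∑ i, lin (L i) ^ 3) ∧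
      (∀ s : ℕ, s ≤ 3 → ∀ L : Fin s → Fin 3 → ℂ, P ≠ ∑ i, lin (L i) ^ 3) := by
  intro P
  constructor
  · obtain ⟨r, hr⟩ := IsAlgClosed.exists_pow_nat_eq (1 / 6 : ℂ) (n := 3) (by norm_num)
    obtain ⟨t, ht⟩ := IsAlgClosed.exists_pow_nat_eq (1 / 3 : ℂ) (n := 3) (by norm_num)
    refine ⟨![![1, 0, 0], ![0, -r, -r], ![0, r, -r], ![0, 0, t]], ?_⟩
    apply MvPolynomial.funext
    intro v
    simp [P, lin, Fin.sum_univ_three, Fin.sum_univ_four]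
    linear_combination (6 * v 1 ^ 2 * v 2 + 2 * v 2 ^ 3) * hr - v 2 ^ 3 * ht
  · intro s hs L hP
    have hL (x y z : ℂ) :
        x ^ 3 - y ^ 2 * z = ∑ i, (L i 0 * x + L i 1 * y + L i 2 * z) ^ 3 := by
      simpa [P, lin, Fin.sum_univ_three] using congrArg (eval ![x, y, z]) hP
    let M (i : Fin 3) : Fin 3 → ℂ := if hi : (i : ℕ) < s then L ⟨i, hi⟩ else 0
    refine cuspidal_cubic_not_sum_three_cubes (M · 0) (M · 1) (M · 2) fun x y z ↦ ?_
    rw [hL]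
    interval_cases s <;> simp [M, Fin.sum_univ_succ]
end

section
/- Any rank five ternary cubic is projectively equivalent to x₀(x₂² + x₀x₁): if F ∈ ℂ[x₀,x₁,x₂] is a homogeneous cubic of Waring rank 5, then there exist an invertible 3×3 complex matrix A and a nonzero scalar c ∈ ℂ such that F(A·x) = c·(x₀x₂² + x₀²x₁), where F(A·x) denotes the cubic obtained from F by the linear change of variables given by A. -/
open MvPolynomial

/-- A function on `ℂ³` is a sum of four cubes of linear forms. -/
def IsSumOfFourCubes (f : (Fin 3 → ℂ) → ℂ) : Prop :=
  ∃ M : Fin 4 → Fin 3 → ℂ, ∀ x, f x = ∑ i, (M i ⬝ᵥ x) ^ 3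

/-- A function on `ℂ³` is projectively equivalent to `x₀(x₂² + x₀x₁)`. -/
def IsConicWithTangent (f : (Fin 3 → ℂ) → ℂ) : Prop :=
  ∃ A : Matrix (Fin 3) (Fin 3) ℂ, A.det ≠ 0 ∧ ∃ c : ℂ, c ≠ 0 ∧
    ∀ x, f (A.mulVec x) = c * (x 0 * x 2 ^ 2 + x 0 ^ 2 * x 1)

lemma IsSumOfFourCubes.of_comp_mulVec {f : (Fin 3 → ℂ) → ℂ} {P : Matrix (Fin 3) (Fin 3) ℂ}
    (hP : P.det ≠ 0) (h : IsSumOfFourCubes fun x => f (P.mulVec x)) : IsSumOfFourCubes f := by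
  obtain ⟨M, hM⟩ := h
  refine ⟨fun i => Matrix.vecMul (M i) P⁻¹, fun x => ?_⟩
  have hx := hM (P⁻¹.mulVec x)
  simp only [Matrix.mulVec_mulVec, Matrix.mul_nonsing_inv P (isUnit_iff_ne_zero.mpr hP),
    Matrix.one_mulVec] at hx
  simpa only [← Matrix.dotProduct_mulVec] using hx

lemma IsConicWithTangent.of_comp_mulVec {f : (Fin 3 → ℂ) → ℂ} {P : Matrix (Fin 3) (Fin 3) ℂ}
    (hP : P.det ≠ 0) (h : IsConicWithTangent fun x => f (P.mulVec x)) : IsConicWithTangent f := by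
  obtain ⟨A, hA, c, hc, h⟩ := h
  refine ⟨P * A, by simp [Matrix.det_mul, hP, hA], c, hc, fun x => ?_⟩
  rw [← Matrix.mulVec_mulVec]
  exact h x

lemma isSumOfFourCubes_of_smul {f : (Fin 3 → ℂ) → ℂ} (c : Fin 4 → ℂ) (M : Fin 4 → Fin 3 → ℂ)
    (h : ∀ x, f x = ∑ i, c i * (M i ⬝ᵥ x) ^ 3) : IsSumOfFourCubes f := by
  choose r hr using fun i => IsAlgClosed.exists_pow_nat_eq (c i) (n := 3) (by norm_num)
  refine ⟨fun i => r i • M i, fun x => ?_⟩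
  simp only [h x, smul_dotProduct, smul_eq_mul, mul_pow, hr]

/-- A depressed binary cubic with nonzero discriminant is a combination of two cubes. -/
lemma exists_two_cubes_of_depressed (m c : ℂ) (hm : m ≠ 0) (hd : 27 * c ^ 2 + 4 * m ^ 3 ≠ 0) :
    ∃ A B α β : ℂ, ∀ x y : ℂ, y ^ 3 + m * x ^ 2 * y + c * x ^ 3 =
      A * (y + α * x) ^ 3 + B * (y + β * x) ^ 3 := by
  obtain ⟨e, rfl⟩ : ∃ e, c = e * m / 3 := ⟨3 * c / m, by field_simp⟩
  obtain ⟨δ, hδ⟩ := IsAlgClosed.exists_pow_nat_eq (e ^ 2 + 4 * m / 3) (n := 2) (by norm_num)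
  have hδ0 : δ ≠ 0 := by
    rintro rfl
    apply hd
    linear_combination (-3 * m ^ 2) * hδ
  obtain rfl : m = 3 * (δ ^ 2 - e ^ 2) / 4 := by linear_combination (-3 / 4) * hδ
  refine ⟨-((e - δ) / 2) / δ, (e + δ) / 2 / δ, (e + δ) / 2, (e - δ) / 2, fun x y => ?_⟩
  field_simp
  ring

/-- If `x²` does not divide a binary cubic, then adding all but finitely many multiples of `x³`
makes it a combination of two cubes. -/
lemma exists_two_cubes_of_generic (g₁ g₂ g₃ : ℂ) (h : g₃ ≠ 0 ∨ g₂ ≠ 0) :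
    ∃ S : Finset ℂ, ∀ c ∉ S, ∃ A B p q p' q' : ℂ, ∀ x y : ℂ,
      c * x ^ 3 + g₁ * x ^ 2 * y + g₂ * x * y ^ 2 + g₃ * y ^ 3 =
        A * (p * x + q * y) ^ 3 + B * (p' * x + q' * y) ^ 3 := by
  by_cases h3 : g₃ = 0
  · have h2 : g₂ ≠ 0 := by tauto
    subst h3
    obtain ⟨k, rfl⟩ : ∃ k, g₁ = 2 * g₂ * k := ⟨g₁ / (2 * g₂), by field_simp⟩
    refine ⟨{g₂ * k ^ 2}, fun c hc => ?_⟩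
    have hc' : c - g₂ * k ^ 2 ≠ 0 := by simpa [sub_eq_zero] using hc
    obtain ⟨β, hβ⟩ := IsAlgClosed.exists_pow_nat_eq (g₂ / (3 * (c - g₂ * k ^ 2))) (n := 2)
      (by norm_num)
    have hβ' : 3 * (c - g₂ * k ^ 2) * β ^ 2 = g₂ := by rw [hβ]; field_simp
    refine ⟨(c - g₂ * k ^ 2) / 2, (c - g₂ * k ^ 2) / 2, 1 + β * k, β, 1 - β * k, -β,
      fun x y => ?_⟩
    linear_combination (-x * (y + k * x) ^ 2) * hβ'
  · obtain ⟨k, rfl⟩ : ∃ k, g₂ = 3 * g₃ * k := ⟨g₂ / (3 * g₃), by field_simp⟩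
    obtain ⟨m, rfl⟩ : ∃ m, g₁ = g₃ * (m + 3 * k ^ 2) := ⟨g₁ / g₃ - 3 * k ^ 2, by field_simp; ring⟩
    by_cases hm : m = 0
    · subst hm
      exact ⟨∅, fun c _ => ⟨g₃, c - g₃ * k ^ 3, k, 1, 1, 0, fun x y => by ring⟩⟩
    obtain ⟨r, hr⟩ := IsAlgClosed.exists_pow_nat_eq (-4 * m ^ 3 / 27) (n := 2) (by norm_num)
    refine ⟨{g₃ * (r + k ^ 3 + m * k), g₃ * (-r + k ^ 3 + m * k)}, fun c hc => ?_⟩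
    obtain ⟨d, rfl⟩ : ∃ d, c = g₃ * (d + k ^ 3 + m * k) :=
      ⟨c / g₃ - k ^ 3 - m * k, by field_simp; ring⟩
    have hd : 27 * d ^ 2 + 4 * m ^ 3 ≠ 0 := by
      intro hd
      have : (d - r) * (d + r) = 0 := by linear_combination hd / 27 - hr
      apply hc
      rcases mul_eq_zero.mp this with h | h
      · simp [sub_eq_zero.mp h]
      · simp [eq_neg_of_add_eq_zero_left h]
    obtain ⟨A, B, α, β, hAB⟩ := exists_two_cubes_of_depressed m d hm hd
    refine ⟨g₃ * A, g₃ * B, k + α, 1, k + β, 1, fun x y => ?_⟩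
    linear_combination g₃ * hAB x (y + k * x)

/-- A sum of a cubic in `x, y` and `h x² z` is a sum of four cubes or a conic with a tangent
line. -/
lemma isSumOfFourCubes_or_isConicWithTangent_of_binary (g₀ g₁ g₂ g₃ h : ℂ) :
    let f : (Fin 3 → ℂ) → ℂ := fun x => g₀ * x 0 ^ 3 + g₁ * x 0 ^ 2 * x 1 + g₂ * x 0 * x 1 ^ 2 +
      g₃ * x 1 ^ 3 + h * x 0 ^ 2 * x 2
    IsSumOfFourCubes f ∨ IsConicWithTangent f := by
  intro f
  by_cases hg : g₃ = 0 ∧ g₂ ≠ 0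
  · obtain ⟨rfl, h2⟩ := hg
    by_cases hh : h = 0
    · subst hh
      left
      obtain ⟨S, hS⟩ := exists_two_cubes_of_generic g₁ g₂ 0 (Or.inr h2)
      obtain ⟨c, hc⟩ := Infinite.exists_notMem_finset S
      obtain ⟨A, B, p, q, p', q', H⟩ := hS c hc
      refine isSumOfFourCubes_of_smul ![A, B, g₀ - c, 0]
        ![![p, q, 0], ![p', q', 0], ![1, 0, 0], 0] fun x => ?_
      simp [Fin.sum_univ_four, dotProduct, Fin.sum_univ_three, f]
      linear_combination H (x 0) (x 1)
    · right
      refine ⟨!![1, 0, 0; 0, 0, 1; -g₀ / h, g₂ / h, -g₁ / h], ?_, g₂, h2, fun x => ?_⟩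
      · simp [Matrix.det_fin_three, h2, hh]
      · simp [dotProduct, Fin.sum_univ_three, f]
        field_simp
        ring
  · left
    obtain ⟨k, hk⟩ : ∃ k, g₂ = 3 * g₃ * k := by
      by_cases h3 : g₃ = 0
      · exact ⟨0, by simp_all⟩
      · exact ⟨g₂ / (3 * g₃), by field_simp⟩
    subst hk
    refine isSumOfFourCubes_of_smul ![g₃, 1 / 6, 1 / 6, -1 / 3]
      ![![k, 1, 0], ![1 + (g₀ - g₃ * k ^ 3), g₁ - 3 * g₃ * k ^ 2, h],
        ![(g₀ - g₃ * k ^ 3) - 1, g₁ - 3 * g₃ * k ^ 2, h],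
        ![g₀ - g₃ * k ^ 3, g₁ - 3 * g₃ * k ^ 2, h]] fun x => ?_
    simp [Fin.sum_univ_four, dotProduct, Fin.sum_univ_three, f]
    ring

/-- A sum of a cubic in `x, y` and a cubic in `x, z` is a sum of four cubes or a conic with a
tangent line. -/
lemma isSumOfFourCubes_or_isConicWithTangent_of_split (g₀ g₁ g₂ g₃ h₁ h₂ h₃ : ℂ) :
    let f : (Fin 3 → ℂ) → ℂ := fun x => g₀ * x 0 ^ 3 + g₁ * x 0 ^ 2 * x 1 + g₂ * x 0 * x 1 ^ 2 +
      g₃ * x 1 ^ 3 + h₁ * x 0 ^ 2 * x 2 + h₂ * x 0 * x 2 ^ 2 + h₃ * x 2 ^ 3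
    IsSumOfFourCubes f ∨ IsConicWithTangent f := by
  intro f
  by_cases hh : h₃ ≠ 0 ∨ h₂ ≠ 0
  · by_cases hg : g₃ ≠ 0 ∨ g₂ ≠ 0
    · left
      obtain ⟨S, hS⟩ := exists_two_cubes_of_generic g₁ g₂ g₃ hg
      obtain ⟨T, hT⟩ := exists_two_cubes_of_generic h₁ h₂ h₃ hh
      obtain ⟨c, hc⟩ := Infinite.exists_notMem_finset (S ∪ T.image (g₀ - ·))
      simp only [Finset.mem_union, Finset.mem_image, not_or, not_exists, not_and] at hc
      obtain ⟨A, B, p, q, p', q', H⟩ := hS c hc.1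
      obtain ⟨A', B', r, s, r', s', H'⟩ := hT (g₀ - c) fun hmem => hc.2 _ hmem (by ring)
      refine isSumOfFourCubes_of_smul ![A, B, A', B']
        ![![p, q, 0], ![p', q', 0], ![r, 0, s], ![r', 0, s']] fun x => ?_
      simp [Fin.sum_univ_four, dotProduct, Fin.sum_univ_three, f]
      linear_combination H (x 0) (x 1) + H' (x 0) (x 2)
    · push Not at hg
      obtain ⟨rfl, rfl⟩ := hg
      have hP : (!![1, 0, 0; 0, 0, 1; 0, 1, 0] : Matrix (Fin 3) (Fin 3) ℂ).det ≠ 0 := by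
        simp [Matrix.det_fin_three]
      have key := isSumOfFourCubes_or_isConicWithTangent_of_binary g₀ h₁ h₂ h₃ g₁
      refine key.imp (fun H => .of_comp_mulVec hP ?_) (fun H => .of_comp_mulVec hP ?_) <;>
      · convert H using 2 with x
        simp [dotProduct, Fin.sum_univ_three, f]
        ring
  · push Not at hh
    obtain ⟨rfl, rfl⟩ := hh
    simpa [f] using isSumOfFourCubes_or_isConicWithTangent_of_binary g₀ g₁ g₂ g₃ h₁

/-- A pencil of `3 × 3` matrices contains a singular member. -/
lemma exists_det_smul_add_smul_eq_zero (M N : Matrix (Fin 3) (Fin 3) ℂ) :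
    ∃ s t : ℂ, (s ≠ 0 ∨ t ≠ 0) ∧ (s • M + t • N).det = 0 := by
  by_cases hN : N.det = 0
  · exact ⟨0, 1, by simp, by simpa using hN⟩
  obtain ⟨μ, hμ⟩ := Module.End.exists_eigenvalue (Matrix.toLin' (N⁻¹ * M))
  obtain ⟨v, hv⟩ := hμ.exists_hasEigenvector
  refine ⟨1, -μ, by simp, Matrix.exists_mulVec_eq_zero_iff.mp ⟨v, hv.2, ?_⟩⟩
  have h := congrArg N.mulVec hv.apply_eq_smul
  rw [Matrix.toLin'_apply, Matrix.mulVec_mulVec, Matrix.mul_nonsing_inv_cancel_left _ _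
    (isUnit_iff_ne_zero.mpr hN), Matrix.mulVec_smul] at h
  rw [Matrix.add_mulVec, Matrix.smul_mulVec, Matrix.smul_mulVec, h]
  simp

/-- The Hessian curve of a sum of cubes meets every line. -/
lemma exists_hessian_point_on_line {n : ℕ} (L : Fin n → Fin 3 → ℂ) (a b : Fin 3 → ℂ) :
    ∃ s t : ℂ, (s ≠ 0 ∨ t ≠ 0) ∧ ∃ u : Fin 3 → ℂ, u ≠ 0 ∧
      ∑ i, ((L i ⬝ᵥ (s • a + t • b)) * (L i ⬝ᵥ u)) • L i = 0 := by
  obtain ⟨s, t, hst, h⟩ := exists_det_smul_add_smul_eq_zero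
    (∑ i, (L i ⬝ᵥ a) • Matrix.vecMulVec (L i) (L i))
    (∑ i, (L i ⬝ᵥ b) • Matrix.vecMulVec (L i) (L i))
  obtain ⟨u, hu, h⟩ := Matrix.exists_mulVec_eq_zero_iff.mpr h
  refine ⟨s, t, hst, u, hu, ?_⟩
  rw [← h, Matrix.add_mulVec, Matrix.smul_mulVec, Matrix.smul_mulVec, Matrix.sum_mulVec,
    Matrix.sum_mulVec, Finset.smul_sum, Finset.smul_sum, ← Finset.sum_add_distrib]
  refine Finset.sum_congr rfl fun i _ => ?_
  ext j
  simp [Matrix.smul_mulVec, Matrix.vecMulVec_mulVec]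
  ring

/-- Every sum of cubes in three variables is annihilated by the product of two independent
derivations. -/
lemma exists_independent_apolar_pair {n : ℕ} (L : Fin n → Fin 3 → ℂ) :
    ∃ u v : Fin 3 → ℂ, LinearIndependent ℂ ![u, v] ∧
      ∑ i, ((L i ⬝ᵥ u) * (L i ⬝ᵥ v)) • L i = 0 := by
  by_contra! H
  have double : ∀ u v : Fin 3 → ℂ, u ≠ 0 → v ≠ 0 →
      ∑ i, ((L i ⬝ᵥ u) * (L i ⬝ᵥ v)) • L i = 0 →
      ∑ i, ((L i ⬝ᵥ u) * (L i ⬝ᵥ u)) • L i = 0 := by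
    intro u v hu hv h
    have hdep : ¬ LinearIndependent ℂ ![u, v] := fun hi => H u v hi h
    rw [LinearIndependent.pair_iff' hu] at hdep
    push Not at hdep
    obtain ⟨a, rfl⟩ := hdep
    have ha : a ≠ 0 := by rintro rfl; simp at hv
    refine (smul_eq_zero_iff_right ha).mp ?_
    rw [← h, Finset.smul_sum]
    refine Finset.sum_congr rfl fun i _ => ?_
    rw [smul_smul, dotProduct_smul, smul_eq_mul]
    ring_nf
  have point : ∀ a b : Fin 3 → ℂ, LinearIndependent ℂ ![a, b] → ∃ s t : ℂ,
      s • a + t • b ≠ 0 ∧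
      ∑ i, ((L i ⬝ᵥ (s • a + t • b)) * (L i ⬝ᵥ (s • a + t • b))) • L i = 0 := by
    intro a b hab
    obtain ⟨s, t, hst, u, hu, h⟩ := exists_hessian_point_on_line L a b
    have hne : s • a + t • b ≠ 0 := by
      intro h0
      have := LinearIndependent.pair_iff.mp hab s t h0
      tauto
    exact ⟨s, t, hne, double _ _ hne hu h⟩
  have std : ∀ i j : Fin 3, i ≠ j →
      LinearIndependent ℂ ![(Pi.single i 1 : Fin 3 → ℂ), Pi.single j 1] := by
    intro i j hij
    rw [LinearIndependent.pair_iff]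
    intro s t h
    exact ⟨by simpa [hij, hij.symm] using congrFun h i, by simpa [hij, hij.symm] using congrFun h j⟩
  obtain ⟨s, t, hv, h⟩ := point _ _ (std 0 1 (by decide))
  set v := s • (Pi.single 0 1 : Fin 3 → ℂ) + t • Pi.single 1 1 with hvdef
  obtain ⟨k, hk⟩ := Function.ne_iff.mp hv
  obtain ⟨i, j, hij, hik, hjk⟩ : ∃ i j : Fin 3, i ≠ j ∧ i ≠ k ∧ j ≠ k := by
    clear_value v
    clear hk
    revert k
    decide
  obtain ⟨s', t', hw, h'⟩ := point _ _ (std i j hij)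
  set w := s' • (Pi.single i 1 : Fin 3 → ℂ) + t' • Pi.single j 1 with hwdef
  have hwk : w k = 0 := by simp [hwdef, hik.symm, hjk.symm]
  have hvw : LinearIndependent ℂ ![w, v] := by
    rw [LinearIndependent.pair_iff' hw]
    intro a ha
    apply hk
    simp [← ha, hwk]
  refine H (w - v) (w + v) ?_ ?_
  · rw [LinearIndependent.pair_iff] at hvw ⊢
    intro a b hab
    obtain ⟨h1, h2⟩ := hvw (a + b) (b - a) (by rw [← hab]; module)
    exact ⟨by linear_combination h1 / 2 - h2 / 2, by linear_combination h1 / 2 + h2 / 2⟩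
  · have := congrArg₂ (· - ·) h' h
    simp only [sub_zero, ← Finset.sum_sub_distrib, ← sub_smul] at this
    rw [← this]
    refine Finset.sum_congr rfl fun i _ => congrArg (· • L i) ?_
    rw [dotProduct_sub (L i) w v, dotProduct_add (L i) w v]
    ring

/-- Two independent vectors of `ℂ³` extend to a basis. -/
lemma exists_det_ne_zero_of_pair {u v : Fin 3 → ℂ} (h : LinearIndependent ℂ ![u, v]) :
    ∃ w : Fin 3 → ℂ, (Matrix.of ![w, u, v]).det ≠ 0 := by
  rw [← crossProduct_ne_zero_iff_linearIndependent] at h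
  obtain ⟨k, hk⟩ := Function.ne_iff.mp h
  refine ⟨Pi.single k 1, ?_⟩
  have := triple_product_eq_det (Pi.single k 1) u v
  rw [single_one_dotProduct] at this
  change Matrix.det ![Pi.single k 1, u, v] ≠ 0
  rw [← this]
  exact hk

/-- Every ternary cubic is a sum of four cubes or a conic with a tangent line. -/
lemma isSumOfFourCubes_or_isConicWithTangent {n : ℕ} (L : Fin n → Fin 3 → ℂ) :
    IsSumOfFourCubes (fun x => ∑ i, (L i ⬝ᵥ x) ^ 3) ∨
      IsConicWithTangent (fun x => ∑ i, (L i ⬝ᵥ x) ^ 3) := by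
  obtain ⟨u, v, huv, h⟩ := exists_independent_apolar_pair L
  obtain ⟨w, hw⟩ := exists_det_ne_zero_of_pair huv
  have hP : (Matrix.of ![w, u, v]).transpose.det ≠ 0 := by rwa [Matrix.det_transpose]
  have apolar : ∀ y, ∑ i, (L i ⬝ᵥ u) * (L i ⬝ᵥ v) * (L i ⬝ᵥ y) = 0 := by
    intro y
    have := congrArg (· ⬝ᵥ y) h
    simpa [sum_dotProduct, smul_dotProduct] using this
  have expand : (fun x => ∑ i, (L i ⬝ᵥ (Matrix.of ![w, u, v]).transpose.mulVec x) ^ 3) =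
      fun x : Fin 3 → ℂ => (∑ i, (L i ⬝ᵥ w) ^ 3) * x 0 ^ 3 +
        (∑ i, 3 * (L i ⬝ᵥ w) ^ 2 * (L i ⬝ᵥ u)) * x 0 ^ 2 * x 1 +
        (∑ i, 3 * (L i ⬝ᵥ w) * (L i ⬝ᵥ u) ^ 2) * x 0 * x 1 ^ 2 +
        (∑ i, (L i ⬝ᵥ u) ^ 3) * x 1 ^ 3 +
        (∑ i, 3 * (L i ⬝ᵥ w) ^ 2 * (L i ⬝ᵥ v)) * x 0 ^ 2 * x 2 +
        (∑ i, 3 * (L i ⬝ᵥ w) * (L i ⬝ᵥ v) ^ 2) * x 0 * x 2 ^ 2 +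
        (∑ i, (L i ⬝ᵥ v) ^ 3) * x 2 ^ 3 := by
    funext x
    have hx : (Matrix.of ![w, u, v]).transpose.mulVec x = x 0 • w + x 1 • u + x 2 • v := by
      ext j
      simp [Matrix.mulVec, dotProduct, Fin.sum_univ_three]
      ring
    rw [← sub_eq_zero]
    have hsum : (6 * x 0 * x 1 * x 2) * ∑ i, (L i ⬝ᵥ u) * (L i ⬝ᵥ v) * (L i ⬝ᵥ w) +
        (3 * x 1 ^ 2 * x 2) * ∑ i, (L i ⬝ᵥ u) * (L i ⬝ᵥ v) * (L i ⬝ᵥ u) +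
        (3 * x 1 * x 2 ^ 2) * ∑ i, (L i ⬝ᵥ u) * (L i ⬝ᵥ v) * (L i ⬝ᵥ v) = 0 := by
      simp [apolar]
    rw [← hsum]
    simp only [hx, dotProduct_add, dotProduct_smul, smul_eq_mul, Finset.mul_sum, Finset.sum_mul,
      ← Finset.sum_add_distrib, ← Finset.sum_sub_distrib]
    exact Finset.sum_congr rfl fun i _ => by ring
  refine (isSumOfFourCubes_or_isConicWithTangent_of_split _ _ _ _ _ _ _).imp
    (fun H => .of_comp_mulVec hP (expand ▸ H)) (fun H => .of_comp_mulVec hP (expand ▸ H))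

lemma eval_lin {n : ℕ} (a x : Fin n → ℂ) : eval x (lin a) = a ⬝ᵥ x := by
  simp [lin, dotProduct]

/-- Any ternary cubic of Waring rank five is projectively equivalent to
`x₀(x₂² + x₀x₁)`: there is an invertible linear change of variables `A` and a nonzero
scalar `c` with `F(A·x) = c·(x₀x₂² + x₀²x₁)`. -/
theorem rank_five_ternary_cubic_projectively_equivalent_to_normal_form
    (F : MvPolynomial (Fin 3) ℂ) (hF : F.IsHomogeneous 3)
    (hrank5 : ∃ L : Fin 5 → Fin 3 → ℂ, F = ∑ i, lin (L i) ^ 3)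
    (hnot4 : ∀ s : ℕ, s ≤ 4 → ∀ L : Fin s → Fin 3 → ℂ, F ≠ ∑ i, lin (L i) ^ 3) :
    ∃ A : Matrix (Fin 3) (Fin 3) ℂ, A.det ≠ 0 ∧
      ∃ c : ℂ, c ≠ 0 ∧
        aeval (fun i => ∑ j, MvPolynomial.C (A i j) * X j) F =
          MvPolynomial.C c * (X 0 * X 2 ^ 2 + X 0 ^ 2 * X 1) := by
  obtain ⟨L, rfl⟩ := hrank5
  have eval_sum : ∀ x, eval x (∑ i, lin (L i) ^ 3) = ∑ i, (L i ⬝ᵥ x) ^ 3 := fun x => by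
    simp [eval_lin]
  rcases isSumOfFourCubes_or_isConicWithTangent L with ⟨M, hM⟩ | ⟨A, hA, c, hc, h⟩
  · refine absurd (MvPolynomial.funext fun x => ?_) (hnot4 4 le_rfl M)
    refine (eval_sum x).trans ((hM x).trans ?_)
    simp [eval_lin]
  · refine ⟨A, hA, c, hc, MvPolynomial.funext fun x => ?_⟩
    have hx : eval x (aeval (fun i => ∑ j, MvPolynomial.C (A i j) * X j) (∑ i, lin (L i) ^ 3)) =
        eval (A.mulVec x) (∑ i, lin (L i) ^ 3) := by
      simp [lin, Matrix.mulVec, dotProduct]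
    refine hx.trans ((eval_sum _).trans ((h x).trans ?_))
    simp
end

section
/- For all integers d ≥ 3, n ≥ 6, and r with 0 ≤ r ≤ d + n − 1, one has C(r,n) + n·r < C(d+n,d); that is, ρ(d,r,n) < 0. In particular, C(d+n−2, d−2) > d(d−1) for all d ≥ 3 and n ≥ 6, and n(d+n−1) < C(d+n−1, d). -/
theorem succ_mul_succ_lt_choose {k n : ℕ} (hk : 1 ≤ k) (hn : 6 ≤ n) :
    (k + 2) * (k + 1) < (k + n).choose k := by
  have h_mono : (k + 6).choose 6 ≤ (k + n).choose k := by
    rw [← Nat.choose_symm_add]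
    exact Nat.choose_le_choose k (by omega)
  refine lt_of_lt_of_le ?_ h_mono
  have h_asc := Nat.ascFactorial_eq_factorial_mul_choose k 6
  simp only [Nat.ascFactorial, Nat.factorial] at h_asc
  have h_quartic : 4 * 5 * 6 * 7 ≤ (k + 3) * (k + 4) * (k + 5) * (k + 6) := by
    gcongr <;> omega
  nlinarith [Nat.mul_le_mul_left ((k + 2) * (k + 1)) h_quartic]

theorem mul_choose_add_eq (k n : ℕ) :
    n * (k + n + 1) * (k + n).choose k = (k + n + 1).choose (k + 2) * ((k + 2) * (k + 1)) := by
  have h_succ := Nat.add_one_mul_choose_eq (k + n) k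
  have h_right := Nat.choose_succ_right_eq (k + n + 1) (k + 1)
  rw [show k + n + 1 - (k + 1) = n by omega] at h_right
  linear_combination n * h_succ - (k + 1) * h_right

/-- For `d ≥ 3`, `n ≥ 6` and `r ≤ d + n − 1` one has `ρ(d,r,n) < 0`, i.e.
`C(r,n) + nr < C(d+n,d)`; in particular `C(d+n−2,d−2) > d(d−1)` and
`n(d+n−1) < C(d+n−1,d)`. -/
theorem rho_neg_of_n_ge_six (d n : ℕ) (hd : 3 ≤ d) (hn : 6 ≤ n) :
    (∀ r : ℕ, r ≤ d + n - 1 → r.choose n + n * r < (d + n).choose d) ∧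
      d * (d - 1) < (d + n - 2).choose (d - 2) ∧
      n * (d + n - 1) < (d + n - 1).choose d := by
  obtain ⟨k, rfl⟩ : ∃ k, d = k + 2 := ⟨d - 2, by omega⟩
  rw [show k + 2 + n - 1 = k + n + 1 by omega, show k + 2 + n - 2 = k + n by omega,
    show k + 2 - 1 = k + 1 by omega, show k + 2 - 2 = k by omega,
    show k + 2 + n = k + n + 1 + 1 by omega]
  have h_choose := succ_mul_succ_lt_choose (show 1 ≤ k by omega) hn
  have h_lt : n * (k + n + 1) < (k + n + 1).choose (k + 2) := by
    refine Nat.lt_of_mul_lt_mul_right (a := (k + 2) * (k + 1)) ?_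
    rw [← mul_choose_add_eq]
    exact Nat.mul_lt_mul_of_pos_left h_choose (by positivity)
  refine ⟨fun r hr => ?_, h_choose, h_lt⟩
  have h_symm : (k + n + 1).choose n = (k + n + 1).choose (k + 1) :=
    Nat.choose_symm_of_eq_add (by omega)
  calc r.choose n + n * r
      ≤ (k + n + 1).choose n + n * (k + n + 1) := by
        gcongr
    _ < (k + n + 1).choose (k + 1) + (k + n + 1).choose (k + 2) := by omega
    _ = (k + n + 1 + 1).choose (k + 2) := (Nat.choose_succ_succ _ _).symm
end
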